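/- In the linear de-preferential attachment model with m = 1, for any C > 2√2, P(sup_k |N_k(n) − E[N_k(n)]| ≥ C√(n log n)) → 0 as n → ∞, where N_k(n) is the number of vertices of degree k in G_n. -/

import Mathlib

open MeasureTheory ProbabilityTheory

/-- The chord bound for the exponential on `[-c, c]`. -/
lemma exp_mul_le_cosh_add_sinh {c x : ℝ} (hc : 0 < c) (hx : |x| ≤ c) (s : ℝ) :
    Real.exp (s * x) ≤ Real.cosh (s * c) + x * (Real.sinh (s * c) / c) := by
  obtain ⟨h1, h2⟩ := abs_le.mp hx
  have h := convexOn_exp.2 (Set.mem_univ (s * c)) (Set.mem_univ (-(s * c)))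
    (div_nonneg (by linarith) (by linarith) : 0 ≤ (c + x) / (2 * c))
    (div_nonneg (by linarith) (by linarith) : 0 ≤ (c - x) / (2 * c))
    (by field_simp; ring)
  have e : (c + x) / (2 * c) * (s * c) + (c - x) / (2 * c) * -(s * c) = s * x := by
    field_simp; ring
  simp only [smul_eq_mul] at h
  rw [e] at h
  refine h.trans_eq ?_
  rw [Real.cosh_eq, Real.sinh_eq]
  field_simp
  ring

section Azuma

variable {Ω : Type*} {m0 : MeasurableSpace Ω} {μ : Measure Ω} [IsProbabilityMeasure μ]
  {ℱ : ℕ → MeasurableSpace Ω} {Z : ℕ → Ω → ℝ} {N : ℕ} {c : ℝ}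

lemma integrable_exp_mul_of_abs_le {X : Ω → ℝ} (hX : Measurable X) {b : ℝ}
    (hb : ∀ ω, |X ω| ≤ b) (s : ℝ) : Integrable (fun ω => Real.exp (s * X ω)) μ := by
  refine Integrable.of_bound (by fun_prop) (Real.exp (|s| * b)) (ae_of_all _ fun ω => ?_)
  rw [Real.norm_eq_abs, Real.abs_exp, Real.exp_le_exp]
  calc s * X ω ≤ |s * X ω| := le_abs_self _
    _ = |s| * |X ω| := abs_mul _ _
    _ ≤ |s| * b := by gcongr; exact hb ω

lemma abs_le_mul_of_abs_sub_le (hZ0 : ∀ ω, Z 0 ω = 0)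
    (hbdd : ∀ j < N, ∀ ω, |Z (j + 1) ω - Z j ω| ≤ c) {j : ℕ} (hj : j ≤ N) (ω : Ω) :
    |Z j ω| ≤ j * c := by
  induction j with
  | zero => simp [hZ0]
  | succ j ih =>
    have h1 := ih (by omega)
    have h2 := hbdd j (by omega) ω
    have h3 := abs_add_le (Z j ω) (Z (j + 1) ω - Z j ω)
    rw [add_sub_cancel] at h3
    push_cast
    linarith

/-- The moment generating function bound behind the Azuma–Hoeffding inequality. -/
lemma integral_exp_mul_le_of_condExp_sub_eq_zero (hℱ : ∀ j, ℱ j ≤ m0) (hc : 0 < c)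
    (hmeas : ∀ j ≤ N, Measurable[ℱ j] (Z j)) (hZ0 : ∀ ω, Z 0 ω = 0)
    (hmart : ∀ j < N, μ[fun ω => Z (j + 1) ω - Z j ω | ℱ j] =ᵐ[μ] 0)
    (hbdd : ∀ j < N, ∀ ω, |Z (j + 1) ω - Z j ω| ≤ c) (s : ℝ) {j : ℕ} (hj : j ≤ N) :
    ∫ ω, Real.exp (s * Z j ω) ∂μ ≤ Real.exp (j * ((s * c) ^ 2 / 2)) := by
  have hm : ∀ j ≤ N, Measurable (Z j) := fun j hj => (hmeas j hj).mono (hℱ j) le_rfl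
  have hint : ∀ j ≤ N, Integrable (fun ω => Real.exp (s * Z j ω)) μ := fun j hj =>
    integrable_exp_mul_of_abs_le (hm j hj) (abs_le_mul_of_abs_sub_le hZ0 hbdd hj) s
  induction j with
  | zero => simp [hZ0]
  | succ j ih =>
    have hjN : j < N := hj
    set Y : Ω → ℝ := fun ω => Real.exp (s * Z j ω) with hY
    set D : Ω → ℝ := fun ω => Z (j + 1) ω - Z j ω with hD
    have hDm : Measurable D := (hm _ hj).sub (hm _ hjN.le)
    have hDint : Integrable D μ :=
      Integrable.of_bound hDm.aestronglyMeasurable c (ae_of_all _ (hbdd j hjN))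
    have hYD : Integrable (fun ω => Y ω * D ω) μ :=
      (hint j hjN.le).mul_bdd (c := c) hDm.aestronglyMeasurable (ae_of_all _ (hbdd j hjN))
    have hYmeas : StronglyMeasurable[ℱ j] Y :=
      (Real.measurable_exp.comp ((hmeas j hjN.le).const_mul s)).stronglyMeasurable
    have hzero : ∫ ω, Y ω * D ω ∂μ = 0 := by
      rw [← integral_condExp (hℱ j)]
      have h1 : μ[fun ω => Y ω * D ω | ℱ j] =ᵐ[μ] Y * μ[D | ℱ j] :=
        condExp_mul_of_stronglyMeasurable_left hYmeas hYD hDint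
      rw [integral_congr_ae (g := fun _ => (0 : ℝ)), integral_zero]
      filter_upwards [h1, hmart j hjN] with ω h2 h3
      rw [h2, Pi.mul_apply, h3]
      simp
    calc ∫ ω, Real.exp (s * Z (j + 1) ω) ∂μ
        ≤ ∫ ω, (Real.cosh (s * c) * Y ω + Real.sinh (s * c) / c * (Y ω * D ω)) ∂μ := by
          refine integral_mono (hint _ hj) (((hint j hjN.le).const_mul _).add (hYD.const_mul _))
            fun ω => ?_
          have h := exp_mul_le_cosh_add_sinh hc (hbdd j hjN ω) s
          have e : Real.exp (s * Z (j + 1) ω) = Y ω * Real.exp (s * D ω) := by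
            rw [hY, hD, ← Real.exp_add]; ring_nf
          have h' := mul_le_mul_of_nonneg_left h (Real.exp_pos (s * Z j ω)).le
          simp only [e]
          refine h'.trans_eq ?_
          simp only [hY, hD]
          ring
      _ = Real.cosh (s * c) * ∫ ω, Y ω ∂μ := by
          rw [integral_add ((hint j hjN.le).const_mul _) (hYD.const_mul _),
            integral_const_mul, integral_const_mul, hzero, mul_zero, add_zero]
      _ ≤ Real.exp ((s * c) ^ 2 / 2) * Real.exp (j * ((s * c) ^ 2 / 2)) := by
          gcongr
          · exact Real.cosh_le_exp_half_sq _
          · exact ih hjN.le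
      _ = Real.exp ((j + 1 : ℕ) * ((s * c) ^ 2 / 2)) := by
          rw [← Real.exp_add]; push_cast; ring_nf

/-- One-sided **Azuma–Hoeffding inequality** with finite horizon. -/
lemma measureReal_ge_le_of_condExp_sub_eq_zero (hℱ : ∀ j, ℱ j ≤ m0) (hc : 0 < c)
    (hmeas : ∀ j ≤ N, Measurable[ℱ j] (Z j)) (hZ0 : ∀ ω, Z 0 ω = 0)
    (hmart : ∀ j < N, μ[fun ω => Z (j + 1) ω - Z j ω | ℱ j] =ᵐ[μ] 0)
    (hbdd : ∀ j < N, ∀ ω, |Z (j + 1) ω - Z j ω| ≤ c) {t : ℝ} (ht : 0 ≤ t) :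
    μ.real {ω | t ≤ Z N ω} ≤ Real.exp (-t ^ 2 / (2 * N * c ^ 2)) := by
  rcases Nat.eq_zero_or_pos N with rfl | hN
  · simp
  have hN' : (0 : ℝ) < N := by exact_mod_cast hN
  set s : ℝ := t / (N * c ^ 2) with hs
  have hs0 : 0 ≤ s := by positivity
  have hint : Integrable (fun ω => Real.exp (s * Z N ω)) μ :=
    integrable_exp_mul_of_abs_le ((hmeas N le_rfl).mono (hℱ N) le_rfl)
      (abs_le_mul_of_abs_sub_le hZ0 hbdd le_rfl) s
  calc μ.real {ω | t ≤ Z N ω} ≤ Real.exp (-s * t) * mgf (Z N) μ s :=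
        measure_ge_le_exp_mul_mgf t hs0 hint
    _ ≤ Real.exp (-s * t) * Real.exp (N * ((s * c) ^ 2 / 2)) := by
        gcongr
        exact integral_exp_mul_le_of_condExp_sub_eq_zero hℱ hc hmeas hZ0 hmart hbdd s le_rfl
    _ = Real.exp (-t ^ 2 / (2 * N * c ^ 2)) := by
        rw [← Real.exp_add, hs]
        congr 1
        field_simp
        ring

/-- Two-sided **Azuma–Hoeffding inequality** with finite horizon. -/
lemma measureReal_abs_ge_le_of_condExp_sub_eq_zero (hℱ : ∀ j, ℱ j ≤ m0) (hc : 0 < c)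
    (hmeas : ∀ j ≤ N, Measurable[ℱ j] (Z j)) (hZ0 : ∀ ω, Z 0 ω = 0)
    (hmart : ∀ j < N, μ[fun ω => Z (j + 1) ω - Z j ω | ℱ j] =ᵐ[μ] 0)
    (hbdd : ∀ j < N, ∀ ω, |Z (j + 1) ω - Z j ω| ≤ c) {t : ℝ} (ht : 0 ≤ t) :
    μ.real {ω | t ≤ |Z N ω|} ≤ 2 * Real.exp (-t ^ 2 / (2 * N * c ^ 2)) := by
  have h1 := measureReal_ge_le_of_condExp_sub_eq_zero hℱ hc hmeas hZ0 hmart hbdd ht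
  have h2 := measureReal_ge_le_of_condExp_sub_eq_zero (μ := μ) (Z := fun j ω => -Z j ω) hℱ hc
    (fun j hj => (hmeas j hj).neg) (by simp [hZ0])
    (fun j hj => by
      have e : (fun ω => -Z (j + 1) ω - -Z j ω) = -fun ω => Z (j + 1) ω - Z j ω := by
        ext ω; simp only [Pi.neg_apply]; ring
      rw [e]
      filter_upwards [condExp_neg (fun ω => Z (j + 1) ω - Z j ω) (ℱ j) (μ := μ), hmart j hj]
        with ω h3 h4
      rw [h3, Pi.neg_apply, h4]
      simp)
    (fun j hj ω => by
      rw [show -Z (j + 1) ω - -Z j ω = -(Z (j + 1) ω - Z j ω) by ring, abs_neg]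
      exact hbdd j hj ω) ht
  have hsub : {ω | t ≤ |Z N ω|} ⊆ {ω | t ≤ Z N ω} ∪ {ω | t ≤ -Z N ω} := by
    intro ω hω
    simp only [Set.mem_union, Set.mem_ofPred_eq] at hω ⊢
    exact le_abs.mp hω
  linarith [measureReal_mono hsub (μ := μ), measureReal_union_le (μ := μ) {ω | t ≤ Z N ω}
    {ω | t ≤ -Z N ω}]

end Azuma

/-- The probability that a given vertex of degree `d` is chosen in the linear de-preferential
graph on `l` vertices. -/
noncomputable def deprefProb (l d : ℕ) : ℝ :=
  (1 / ((l : ℝ) - 1)) * (1 - (d : ℝ) / (2 * (l : ℝ) - 1))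

/-- The probability that a vertex of degree `d` in the graph on `l` vertices has degree `k` once
`r` further vertices have been added. -/
noncomputable def deprefTrans (k : ℕ) : ℕ → ℕ → ℕ → ℝ
  | _, 0, d => if d = k then 1 else 0
  | l, r + 1, d => deprefProb l d * deprefTrans k (l + 1) r (d + 1) +
      (1 - deprefProb l d) * deprefTrans k (l + 1) r d

lemma deprefProb_mem_Icc {l d : ℕ} (hl : 2 ≤ l) (hd : d ≤ l) :
    deprefProb l d ∈ Set.Icc (0 : ℝ) 1 := by
  have hl' : (2 : ℝ) ≤ l := by exact_mod_cast hl
  have hd' : (d : ℝ) ≤ l := by exact_mod_cast hd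
  have h1 : (d : ℝ) / (2 * l - 1) ≤ 1 := by rw [div_le_one (by linarith)]; linarith
  have h2 : (0 : ℝ) ≤ d / (2 * l - 1) := div_nonneg (by positivity) (by linarith)
  have h3 : 1 / ((l : ℝ) - 1) ≤ 1 := by rw [div_le_one (by linarith)]; linarith
  have h4 : 0 ≤ 1 / ((l : ℝ) - 1) := div_nonneg zero_le_one (by linarith)
  exact ⟨mul_nonneg h4 (by linarith), mul_le_one₀ h3 (by linarith) (by linarith)⟩

lemma deprefTrans_mem_Icc (k r : ℕ) {l d : ℕ} (hl : 2 ≤ l) (hd : d ≤ l) :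
    deprefTrans k l r d ∈ Set.Icc (0 : ℝ) 1 := by
  induction r generalizing l d with
  | zero => rw [deprefTrans]; split_ifs <;> simp
  | succ r ih =>
    obtain ⟨a1, a2⟩ := deprefProb_mem_Icc hl hd
    rw [deprefTrans]
    exact convex_Icc (0 : ℝ) 1 (ih (l := l + 1) (d := d + 1) (by omega) (by omega))
      (ih (l := l + 1) (d := d) (by omega) (by omega)) a1 (by linarith) (by ring)

lemma abs_deprefTrans_sub_le (k r : ℕ) {l d : ℕ} (hl : 2 ≤ l) (hd : d ≤ l) :
    |deprefTrans k (l + 1) r (d + 1) - deprefTrans k (l + 1) r d| ≤ 1 := by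
  obtain ⟨a1, a2⟩ := deprefTrans_mem_Icc k r (l := l + 1) (d := d + 1) (by omega) (by omega)
  obtain ⟨b1, b2⟩ := deprefTrans_mem_Icc k r (l := l + 1) (d := d) (by omega) (by omega)
  rw [abs_le]
  constructor <;> linarith

section Degrees

variable {d : ℕ → ℕ → ℕ} {A : ℕ → ℕ}

lemma depref_degree_le (hinit : d 1 2 = 2 ∧ d 2 2 = 1)
    (hupdate : ∀ n, 2 ≤ n → ∀ i,
      d i (n + 1) = if i = n + 1 then 1 else d i n + (if A n = i then 1 else 0))
    {l : ℕ} (hl : 2 ≤ l) : ∀ i ∈ Finset.Icc 1 l, d i l ≤ l := by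
  induction l, hl using Nat.le_induction with
  | base =>
    intro i hi
    obtain ⟨h1, h2⟩ := Finset.mem_Icc.mp hi
    interval_cases i <;> omega
  | succ l hl ih =>
    intro i hi
    obtain ⟨h1, h2⟩ := Finset.mem_Icc.mp hi
    rw [hupdate l hl]
    split_ifs with h h' <;> try omega
    all_goals
      have := ih i (Finset.mem_Icc.mpr ⟨h1, by omega⟩)
      omega

lemma sum_Icc_ite_eq {l a : ℕ} (ha : 1 ≤ a ∧ a ≤ l) {R : Type*} [AddCommMonoid R] (f : ℕ → R) :
    ∑ i ∈ Finset.Icc 1 l, (if a = i then f i else 0) = f a := by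
  rw [Finset.sum_ite_eq, if_pos (Finset.mem_Icc.mpr ha)]

lemma sum_depref_degree (hinit : d 1 2 = 2 ∧ d 2 2 = 1)
    (hrange : ∀ n, 2 ≤ n → 1 ≤ A n ∧ A n ≤ n)
    (hupdate : ∀ n, 2 ≤ n → ∀ i,
      d i (n + 1) = if i = n + 1 then 1 else d i n + (if A n = i then 1 else 0))
    {l : ℕ} (hl : 2 ≤ l) : ∑ i ∈ Finset.Icc 1 l, d i l + 1 = 2 * l := by
  induction l, hl using Nat.le_induction with
  | base => simp [Finset.sum_Icc_succ_top, hinit]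
  | succ l hl ih =>
    rw [Finset.sum_Icc_succ_top (by omega), hupdate l hl (l + 1), if_pos rfl]
    have e : ∑ i ∈ Finset.Icc 1 l, d i (l + 1)
        = ∑ i ∈ Finset.Icc 1 l, (d i l + (if A l = i then 1 else 0)) :=
      Finset.sum_congr rfl fun i hi => by
        have := (Finset.mem_Icc.mp hi).2
        rw [hupdate l hl, if_neg (by omega)]
    rw [e, Finset.sum_add_distrib, sum_Icc_ite_eq (hrange l hl) fun _ => 1]
    omega

lemma sum_deprefProb {l : ℕ} (hl : 2 ≤ l) (hsum : ∑ i ∈ Finset.Icc 1 l, d i l + 1 = 2 * l) :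
    ∑ i ∈ Finset.Icc 1 l, deprefProb l (d i l) = 1 := by
  have hl' : (2 : ℝ) ≤ l := by exact_mod_cast hl
  have h1 : (l : ℝ) - 1 ≠ 0 := by linarith
  have h2 : 2 * (l : ℝ) - 1 ≠ 0 := by linarith
  have h3 : ∑ i ∈ Finset.Icc 1 l, (d i l : ℝ) = 2 * l - 1 := by
    rw [eq_sub_iff_add_eq]; exact_mod_cast hsum
  simp only [deprefProb]
  rw [← Finset.mul_sum, Finset.sum_sub_distrib, ← Finset.sum_div, h3, div_self h2]
  simp only [Finset.sum_const, Nat.card_Icc, add_tsub_cancel_right, nsmul_eq_mul, mul_one]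
  field_simp

/-- The conditional expectation of the number of vertices of degree `k` in the graph on `n`
vertices, given the degrees `d i l` in the graph on `l` vertices. -/
noncomputable def deprefDoob (d : ℕ → ℕ → ℕ) (k n l : ℕ) : ℝ :=
  ∑ i ∈ Finset.Icc 1 l, deprefTrans k l (n - l) (d i l) +
    ∑ j ∈ Finset.Ioc l n, deprefTrans k j (n - j) 1

lemma deprefDoob_self (k n : ℕ) :
    deprefDoob d k n n = (((Finset.Icc 1 n).filter (fun i => d i n = k)).card : ℝ) := by
  simp [deprefDoob, deprefTrans]

lemma deprefDoob_succ_sub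
    (hupdate : ∀ n, 2 ≤ n → ∀ i,
      d i (n + 1) = if i = n + 1 then 1 else d i n + (if A n = i then 1 else 0))
    (k : ℕ) {l n : ℕ} (hl : 2 ≤ l) (hln : l < n) :
    deprefDoob d k n (l + 1) - deprefDoob d k n l =
      ∑ i ∈ Finset.Icc 1 l,
        (deprefTrans k (l + 1) (n - (l + 1)) (d i l + 1) -
          deprefTrans k (l + 1) (n - (l + 1)) (d i l)) *
        ((if A l = i then 1 else 0) - deprefProb l (d i l)) := by
  obtain ⟨r, hr⟩ : ∃ r, n = l + 1 + r := ⟨n - (l + 1), by omega⟩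
  have e1 : n - (l + 1) = r := by omega
  have e2 : n - l = r + 1 := by omega
  have e3 : Finset.Ioc l n = insert (l + 1) (Finset.Ioc (l + 1) n) := by
    ext x; simp only [Finset.mem_Ioc, Finset.mem_insert]; omega
  rw [deprefDoob, deprefDoob, e3, Finset.sum_insert (by simp), Finset.sum_Icc_succ_top (by omega),
    hupdate l hl (l + 1), if_pos rfl, e1, e2, add_assoc, add_sub_add_right_eq_sub,
    ← Finset.sum_sub_distrib]
  refine Finset.sum_congr rfl fun i hi => ?_
  have := (Finset.mem_Icc.mp hi).2
  rw [hupdate l hl i, if_neg (by omega), deprefTrans]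
  split_ifs
  · ring
  · rw [add_zero]; ring

lemma abs_deprefDoob_succ_sub_le (hinit : d 1 2 = 2 ∧ d 2 2 = 1)
    (hrange : ∀ n, 2 ≤ n → 1 ≤ A n ∧ A n ≤ n)
    (hupdate : ∀ n, 2 ≤ n → ∀ i,
      d i (n + 1) = if i = n + 1 then 1 else d i n + (if A n = i then 1 else 0))
    (k : ℕ) {l n : ℕ} (hl : 2 ≤ l) (hln : l < n) :
    |deprefDoob d k n (l + 1) - deprefDoob d k n l| ≤ 2 := by
  rw [deprefDoob_succ_sub hupdate k hl hln]
  have hdeg := depref_degree_le hinit hupdate hl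
  calc _ ≤ ∑ i ∈ Finset.Icc 1 l, ((if A l = i then 1 else 0) + deprefProb l (d i l)) := by
        refine (Finset.abs_sum_le_sum_abs _ _).trans (Finset.sum_le_sum fun i hi => ?_)
        have hq := (deprefProb_mem_Icc hl (hdeg i hi)).1
        rw [abs_mul]
        refine (mul_le_of_le_one_left (abs_nonneg _)
          (abs_deprefTrans_sub_le k _ hl (hdeg i hi))).trans ((abs_sub _ _).trans_eq ?_)
        rw [abs_of_nonneg hq, abs_of_nonneg (by split_ifs <;> norm_num)]
    _ = 2 := by
        rw [Finset.sum_add_distrib, sum_Icc_ite_eq (hrange l hl) fun _ => (1 : ℝ),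
          sum_deprefProb hl (sum_depref_degree hinit hrange hupdate hl)]
        norm_num

end Degrees

lemma measurable_deprefDoob {Ω : Type*} {d : ℕ → ℕ → Ω → ℕ} {ℱ : ℕ → MeasurableSpace Ω}
    (hdmeas : ∀ i n, @Measurable Ω ℕ (ℱ n) _ (d i n)) (k n l : ℕ) :
    Measurable[ℱ l] fun ω => deprefDoob (fun i m => d i m ω) k n l :=
  (Finset.measurable_fun_sum _ fun i _ =>
    (Measurable.of_discrete (f := deprefTrans k l (n - l))).comp (hdmeas i l)).add_const _

lemma deprefDoob_two_const {Ω : Type*} {d : ℕ → ℕ → Ω → ℕ}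
    (hinit : ∀ ω, d 1 2 ω = 2 ∧ d 2 2 ω = 1) (k n : ℕ) (ω ω' : Ω) :
    deprefDoob (fun i m => d i m ω) k n 2 = deprefDoob (fun i m => d i m ω') k n 2 := by
  simp [deprefDoob, Finset.sum_Icc_succ_top, hinit]

/-- A supremum over `ℕ` of nonnegative reals which vanish beyond `n` is attained up to `n`. -/
lemma exists_le_of_le_iSup_of_eq_zero {f : ℕ → ℝ} {n : ℕ} {c : ℝ} (h0 : ∀ k, 0 ≤ f k)
    (hf : ∀ k, n < k → f k = 0) (hc : c ≤ ⨆ k, f k) : ∃ k ∈ Finset.range (n + 1), c ≤ f k := by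
  have hne : (Finset.range (n + 1)).Nonempty := ⟨0, by simp⟩
  obtain ⟨k, hk, hk'⟩ := Finset.exists_mem_eq_sup' hne f
  refine ⟨k, hk, hk' ▸ hc.trans (ciSup_le fun j => ?_)⟩
  by_cases hj : n < j
  · exact (hf j hj).trans_le ((h0 0).trans (Finset.le_sup' f (by simp)))
  · exact Finset.le_sup' f (by simp; omega)

section Model

variable {Ω : Type*} [m0 : MeasurableSpace Ω] {μ : Measure Ω} [IsProbabilityMeasure μ]
  {d : ℕ → ℕ → Ω → ℕ} {A : ℕ → Ω → ℕ} {ℱ : ℕ → MeasurableSpace Ω}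

lemma condExp_deprefDoob_succ_sub (hℱ : ∀ n, ℱ n ≤ m0)
    (hdmeas : ∀ i n, @Measurable Ω ℕ (ℱ n) _ (d i n))
    (hAmeas : ∀ n, @Measurable Ω ℕ (ℱ (n + 1)) _ (A n))
    (hinit : ∀ ω, d 1 2 ω = 2 ∧ d 2 2 ω = 1)
    (hupdate : ∀ n : ℕ, 2 ≤ n → ∀ i ω,
      d i (n + 1) ω = if i = n + 1 then 1 else d i n ω + (if A n ω = i then 1 else 0))
    (hlaw : ∀ n : ℕ, 2 ≤ n → ∀ i : ℕ, 1 ≤ i → i ≤ n →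
      μ[(fun ω => Set.indicator {ω' | A n ω' = i} (fun _ => (1 : ℝ)) ω) | ℱ n]
        =ᵐ[μ] fun ω => (1 / ((n : ℝ) - 1)) * (1 - (d i n ω : ℝ) / (2 * (n : ℝ) - 1)))
    (k : ℕ) {l n : ℕ} (hl : 2 ≤ l) (hln : l < n) :
    μ[fun ω => deprefDoob (fun i m => d i m ω) k n (l + 1) -
      deprefDoob (fun i m => d i m ω) k n l | ℱ l] =ᵐ[μ] 0 := by
  set g : ℕ → Ω → ℝ := fun i ω => deprefTrans k (l + 1) (n - (l + 1)) (d i l ω + 1) -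
    deprefTrans k (l + 1) (n - (l + 1)) (d i l ω) with hg
  set I : ℕ → Ω → ℝ := fun i ω => Set.indicator {ω' | A l ω' = i} (fun _ => (1 : ℝ)) ω with hI
  set q : ℕ → Ω → ℝ := fun i ω => deprefProb l (d i l ω) with hq
  have e : (fun ω => deprefDoob (fun i m => d i m ω) k n (l + 1) -
      deprefDoob (fun i m => d i m ω) k n l) = ∑ i ∈ Finset.Icc 1 l, g i * (I i - q i) := by
    ext ω
    rw [deprefDoob_succ_sub (d := fun i m => d i m ω) (A := fun m => A m ω)
      (fun m hm i => hupdate m hm i ω) k hl hln, Finset.sum_apply]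
    simp only [hg, hI, hq, Pi.mul_apply, Pi.sub_apply, Set.indicator_apply, Set.mem_ofPred_eq]
  have hdeg : ∀ i ∈ Finset.Icc 1 l, ∀ ω, d i l ω ≤ l := fun i hi ω =>
    depref_degree_le (d := fun i m => d i m ω) (A := fun m => A m ω) (hinit ω)
      (fun m hm i => hupdate m hm i ω) hl i hi
  have hgm : ∀ i, Measurable[ℱ l] (g i) := fun i =>
    (Measurable.of_discrete (f := fun a => deprefTrans k (l + 1) (n - (l + 1)) (a + 1) -
      deprefTrans k (l + 1) (n - (l + 1)) a)).comp (hdmeas i l)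
  have hqm : ∀ i, Measurable[ℱ l] (q i) := fun i =>
    (Measurable.of_discrete (f := deprefProb l)).comp (hdmeas i l)
  have hIint : ∀ i, Integrable (I i) μ := fun i =>
    (integrable_const (1 : ℝ)).indicator
      (((hAmeas l).mono (hℱ _) le_rfl) (measurableSet_singleton i))
  have hqint : ∀ i ∈ Finset.Icc 1 l, Integrable (q i) μ := fun i hi =>
    Integrable.of_bound ((hqm i).mono (hℱ l) le_rfl).aestronglyMeasurable 1
      (ae_of_all _ fun ω => by
        obtain ⟨h1, h2⟩ := deprefProb_mem_Icc hl (hdeg i hi ω)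
        rwa [Real.norm_eq_abs, abs_of_nonneg h1])
  have hprod : ∀ i ∈ Finset.Icc 1 l, Integrable (g i * (I i - q i)) μ := fun i hi =>
    ((hIint i).sub (hqint i hi)).bdd_mul (c := 1)
      ((hgm i).mono (hℱ l) le_rfl).aestronglyMeasurable
      (ae_of_all _ fun ω => abs_deprefTrans_sub_le k _ hl (hdeg i hi ω))
  have hterm : ∀ i ∈ Finset.Icc 1 l, μ[g i * (I i - q i) | ℱ l] =ᵐ[μ] 0 := fun i hi => by
    obtain ⟨hi1, hi2⟩ := Finset.mem_Icc.mp hi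
    have h1 := condExp_mul_of_stronglyMeasurable_left (hgm i).stronglyMeasurable (hprod i hi)
      ((hIint i).sub (hqint i hi))
    have h2 := condExp_sub (hIint i) (hqint i hi) (ℱ l)
    have h3 := condExp_of_stronglyMeasurable (hℱ l) (hqm i).stronglyMeasurable (hqint i hi)
    filter_upwards [h1, h2, hlaw l hl i hi1 hi2] with ω h4 h5 h6
    rw [h4, Pi.mul_apply, h5, Pi.sub_apply, h3, h6]
    simp [hq, deprefProb]
  rw [e]
  have hall := (Finset.eventually_all (Finset.Icc 1 l)).mpr hterm
  filter_upwards [condExp_finsetSum hprod (ℱ l), hall] with ω h1 h2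
  rw [h1, Finset.sum_apply]
  exact Finset.sum_eq_zero h2

lemma measureReal_depref_abs_sub_ge_le (hℱ : ∀ n, ℱ n ≤ m0)
    (hdmeas : ∀ i n, @Measurable Ω ℕ (ℱ n) _ (d i n))
    (hAmeas : ∀ n, @Measurable Ω ℕ (ℱ (n + 1)) _ (A n))
    (hinit : ∀ ω, d 1 2 ω = 2 ∧ d 2 2 ω = 1)
    (hrange : ∀ n : ℕ, 2 ≤ n → ∀ ω, 1 ≤ A n ω ∧ A n ω ≤ n)
    (hupdate : ∀ n : ℕ, 2 ≤ n → ∀ i ω,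
      d i (n + 1) ω = if i = n + 1 then 1 else d i n ω + (if A n ω = i then 1 else 0))
    (hlaw : ∀ n : ℕ, 2 ≤ n → ∀ i : ℕ, 1 ≤ i → i ≤ n →
      μ[(fun ω => Set.indicator {ω' | A n ω' = i} (fun _ => (1 : ℝ)) ω) | ℱ n]
        =ᵐ[μ] fun ω => (1 / ((n : ℝ) - 1)) * (1 - (d i n ω : ℝ) / (2 * (n : ℝ) - 1)))
    (k N : ℕ) {t : ℝ} (ht : 0 ≤ t) :
    μ.real {ω | t ≤ |(((Finset.Icc 1 (N + 2)).filter (fun i => d i (N + 2) ω = k)).card : ℝ) -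
        ∫ ω', (((Finset.Icc 1 (N + 2)).filter (fun i => d i (N + 2) ω' = k)).card : ℝ) ∂μ|} ≤
      2 * Real.exp (-t ^ 2 / (2 * N * 2 ^ 2)) := by
  set H : ℕ → Ω → ℝ := fun j ω => deprefDoob (fun i m => d i m ω) k (N + 2) (j + 2) with hH
  have hHN : ∀ ω, (((Finset.Icc 1 (N + 2)).filter (fun i => d i (N + 2) ω = k)).card : ℝ)
      = H N ω := fun ω => (deprefDoob_self (d := fun i m => d i m ω) k (N + 2)).symm
  have hmart : ∀ j < N, μ[fun ω => H (j + 1) ω - H j ω | ℱ (j + 2)] =ᵐ[μ] 0 := fun j hj =>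
    condExp_deprefDoob_succ_sub hℱ hdmeas hAmeas hinit hupdate hlaw k (by omega) (by omega)
  have hbdd : ∀ j < N, ∀ ω, |H (j + 1) ω - H j ω| ≤ 2 := fun j hj ω =>
    abs_deprefDoob_succ_sub_le (d := fun i m => d i m ω) (A := fun m => A m ω) (hinit ω)
      (fun m hm => hrange m hm ω) (fun m hm i => hupdate m hm i ω) k (by omega) (by omega)
  have hmeas : ∀ j, Measurable[ℱ (j + 2)] (H j) := fun j => measurable_deprefDoob hdmeas k _ _
  obtain ⟨ω₀⟩ : Nonempty Ω := μ.nonempty_of_neZero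
  have hH0 : ∀ ω, H 0 ω = H 0 ω₀ := fun ω => deprefDoob_two_const hinit k _ ω ω₀
  have hmean : ∀ j ≤ N, Integrable (H j) μ ∧ ∫ ω, H j ω ∂μ = H 0 ω₀ := by
    intro j
    induction j with
    | zero =>
      intro _
      refine ⟨(integrable_congr (ae_of_all _ hH0)).mpr (integrable_const _), ?_⟩
      rw [integral_congr_ae (ae_of_all _ hH0)]
      simp
    | succ j ih =>
      intro hj
      obtain ⟨h1, h2⟩ := ih (by omega)
      have hD : Integrable (fun ω => H (j + 1) ω - H j ω) μ :=
        Integrable.of_bound (((hmeas (j + 1)).mono (hℱ _) le_rfl).sub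
          ((hmeas j).mono (hℱ _) le_rfl)).aestronglyMeasurable 2 (ae_of_all _ (hbdd j hj))
      have hH' : H (j + 1) = fun ω => H j ω + (H (j + 1) ω - H j ω) := by ext; ring
      refine ⟨hH' ▸ h1.add hD, ?_⟩
      have h3 : ∫ ω, (H (j + 1) ω - H j ω) ∂μ = 0 := by
        rw [← integral_condExp (hℱ (j + 2)), integral_congr_ae (hmart j hj)]
        simp
      rw [hH', integral_add h1 hD, h2, h3, add_zero]
  simp only [hHN, (hmean N le_rfl).2]
  exact measureReal_abs_ge_le_of_condExp_sub_eq_zero (Z := fun j ω => H j ω - H 0 ω₀)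
    (ℱ := fun j => ℱ (j + 2)) (fun j => hℱ _) two_pos (fun j _ => (hmeas j).sub_const _)
    (fun ω => sub_eq_zero.mpr (hH0 ω)) (fun j hj => by simpa using hmart j hj)
    (fun j hj ω => by simpa using hbdd j hj ω) ht

end Model

open MeasureTheory ProbabilityTheory

/-- In the linear de-preferential attachment model with `m = 1`, for any `C > 2√2`,
`P(sup_k |N_k(n) - E[N_k(n)]| ≥ C √(n log n)) → 0` as `n → ∞`, where `N_k(n)` is the number
of vertices of degree `k` in `G_n`.
The model: `d i n` is the degree of vertex `i` in `G_n` (starting from `G_2` with degrees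
`d 1 2 = 2`, `d 2 2 = 1`), the vertex `v_{n+1}` attaches to the random vertex `A n`, and
conditionally on `ℱ n` the vertex `i ∈ {1,…,n}` is chosen with probability
`(1/(n-1))(1 - d_i(n)/(2n-1))`. -/
theorem depref_linear_degree_count_concentration
    {Ω : Type*} [MeasurableSpace Ω] (μ : Measure Ω) [IsProbabilityMeasure μ]
    (d : ℕ → ℕ → Ω → ℕ) (A : ℕ → Ω → ℕ) (ℱ : ℕ → MeasurableSpace Ω)
    (hℱ : ∀ n, ℱ n ≤ (inferInstance : MeasurableSpace Ω))
    (hℱmono : ∀ n, ℱ n ≤ ℱ (n + 1))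
    (hdmeas : ∀ i n, @Measurable Ω ℕ (ℱ n) _ (d i n))
    (hAmeas : ∀ n, @Measurable Ω ℕ (ℱ (n + 1)) _ (A n))
    (hinit : ∀ ω, d 1 2 ω = 2 ∧ d 2 2 ω = 1)
    (hrange : ∀ n : ℕ, 2 ≤ n → ∀ ω, 1 ≤ A n ω ∧ A n ω ≤ n)
    (hupdate : ∀ n : ℕ, 2 ≤ n → ∀ i ω,
      d i (n + 1) ω = if i = n + 1 then 1 else d i n ω + (if A n ω = i then 1 else 0))
    (hlaw : ∀ n : ℕ, 2 ≤ n → ∀ i : ℕ, 1 ≤ i → i ≤ n →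
      μ[(fun ω => Set.indicator {ω' | A n ω' = i} (fun _ => (1 : ℝ)) ω) | ℱ n]
        =ᵐ[μ] fun ω => (1 / ((n : ℝ) - 1)) * (1 - (d i n ω : ℝ) / (2 * (n : ℝ) - 1))) :
    ∀ C : ℝ, 2 * Real.sqrt 2 < C →
      Filter.Tendsto
        (fun n : ℕ => μ {ω |
          C * Real.sqrt ((n : ℝ) * Real.log n) ≤
            ⨆ k : ℕ,
              |(((Finset.Icc 1 n).filter (fun i => d i n ω = k)).card : ℝ) -
                ∫ ω', (((Finset.Icc 1 n).filter (fun i => d i n ω' = k)).card : ℝ) ∂μ|})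
        Filter.atTop (nhds 0) := by
  intro C hC
  have hC0 : 0 < C := (by positivity : (0 : ℝ) < 2 * Real.sqrt 2).trans hC
  have hC8 : 8 < C ^ 2 := by
    have h := pow_lt_pow_left₀ hC (by positivity) two_ne_zero
    rw [mul_pow, Real.sq_sqrt zero_le_two] at h
    linarith
  have hlim : Filter.Tendsto
      (fun n : ℕ => ENNReal.ofReal (4 * (n : ℝ) ^ (-(C ^ 2 / 8 - 1)))) Filter.atTop (nhds 0) := by
    have h1 := ((tendsto_rpow_neg_atTop (y := C ^ 2 / 8 - 1) (by linarith)).comp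
      tendsto_natCast_atTop_atTop).const_mul (4 : ℝ)
    simpa using ENNReal.tendsto_ofReal h1
  refine tendsto_of_tendsto_of_tendsto_of_le_of_le' tendsto_const_nhds hlim
    (Filter.Eventually.of_forall fun _ => zero_le) ?_
  filter_upwards [Filter.eventually_ge_atTop 3] with n hn
  obtain ⟨N, rfl⟩ : ∃ N, n = N + 2 := ⟨n - 2, by omega⟩
  set n := N + 2 with hn2
  set t : ℝ := C * Real.sqrt ((n : ℝ) * Real.log n) with ht
  have ht0 : 0 ≤ t := by positivity
  set F : ℕ → Ω → ℝ := fun k ω =>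
    |(((Finset.Icc 1 n).filter (fun i => d i n ω = k)).card : ℝ) -
      ∫ ω', (((Finset.Icc 1 n).filter (fun i => d i n ω' = k)).card : ℝ) ∂μ| with hF
  have hF0 : ∀ ω k, n < k → F k ω = 0 := by
    intro ω k hk
    have hcard : ∀ ω, ((Finset.Icc 1 n).filter (fun i => d i n ω = k)).card = 0 := fun ω => by
      rw [Finset.card_eq_zero, Finset.filter_eq_empty_iff]
      intro i hi
      have := depref_degree_le (d := fun i m => d i m ω) (A := fun m => A m ω) (hinit ω)
        (fun m hm i => hupdate m hm i ω) (by omega : 2 ≤ n) i hi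
      exact (this.trans_lt hk).ne
    simp [hF, hcard]
  have hsub : {ω | t ≤ ⨆ k, F k ω} ⊆ ⋃ k ∈ Finset.range (n + 1), {ω | t ≤ F k ω} := fun ω hω => by
    obtain ⟨k, hk, h⟩ := exists_le_of_le_iSup_of_eq_zero (fun _ => abs_nonneg _) (hF0 ω) hω
    exact Set.mem_biUnion hk h
  have hn1 : (1 : ℝ) ≤ n := by exact_mod_cast (by omega : 1 ≤ n)
  have hN0 : (0 : ℝ) < N := by exact_mod_cast (by omega : 0 < N)
  have hexp : Real.exp (-t ^ 2 / (2 * N * 2 ^ 2)) ≤ (n : ℝ) ^ (-(C ^ 2 / 8)) := by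
    have hlog : 0 ≤ Real.log n := Real.log_nonneg hn1
    rw [Real.rpow_def_of_pos (by linarith), Real.exp_le_exp, ht, mul_pow,
      Real.sq_sqrt (by positivity), div_le_iff₀ (by positivity)]
    have hNn : (N : ℝ) ≤ n := by exact_mod_cast (by omega : N ≤ n)
    have := mul_le_mul_of_nonneg_left hNn (by positivity : 0 ≤ C ^ 2 * Real.log n)
    nlinarith
  have hbound : ∀ k, μ.real {ω | t ≤ F k ω} ≤ 2 * (n : ℝ) ^ (-(C ^ 2 / 8)) := fun k =>
    (measureReal_depref_abs_sub_ge_le hℱ hdmeas hAmeas hinit hrange hupdate hlaw k N ht0).trans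
      (by gcongr)
  rw [← ofReal_measureReal]
  refine ENNReal.ofReal_le_ofReal ?_
  calc μ.real {ω | t ≤ ⨆ k, F k ω}
      ≤ μ.real (⋃ k ∈ Finset.range (n + 1), {ω | t ≤ F k ω}) :=
        measureReal_mono hsub (measure_ne_top _ _)
    _ ≤ ∑ k ∈ Finset.range (n + 1), μ.real {ω | t ≤ F k ω} :=
        measureReal_biUnion_finset_le _ _
    _ ≤ ∑ _k ∈ Finset.range (n + 1), 2 * (n : ℝ) ^ (-(C ^ 2 / 8)) :=
        Finset.sum_le_sum fun k _ => hbound k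
    _ = 2 * (n + 1) * (n : ℝ) ^ (-(C ^ 2 / 8)) := by
        rw [Finset.sum_const, Finset.card_range, nsmul_eq_mul]; push_cast; ring
    _ ≤ 4 * n * (n : ℝ) ^ (-(C ^ 2 / 8)) := by
        refine mul_le_mul_of_nonneg_right ?_ (by positivity)
        linarith
    _ = 4 * (n : ℝ) ^ (-(C ^ 2 / 8 - 1)) := by
        rw [neg_sub, sub_eq_add_neg, Real.rpow_add (by linarith), Real.rpow_one, mul_assoc]
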